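/- If i, j are nonnegative integers with i + j ≤ g, then I ∩ R^i_{(j)} = {0}; that is, the natural map R^i_{(j)} → 𝓡^i_{(j)} is an isomorphism. -/

import Mathlib

/- We model `R = ℚ[x₁, x₂, …]` as `MvPolynomial ℕ ℚ`, the variable of index `v`
representing `x_{v+1}` (so `x_k = X (k-1)` for `k ≥ 1`). -/

open MvPolynomial

noncomputable section

/-- Codimension grading: `codim x_{v+1} = v + 1`. -/
def codimW (d : ℕ →₀ ℕ) : ℕ := d.sum fun v e => (v + 1) * e

/-- Level grading: `ℓ(x_{v+1}) = v`. -/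
def levelW (d : ℕ →₀ ℕ) : ℕ := d.sum fun v e => v * e

/-- `R^i_{(j)}`: the ℚ-span of the monomials of codimension `i` and level `j`. -/
def Rij (i j : ℕ) : Submodule ℚ (MvPolynomial ℕ ℚ) :=
  Submodule.span ℚ
    { p | ∃ d : ℕ →₀ ℕ, codimW d = i ∧ levelW d = j ∧ p = monomial d (1 : ℚ) }

/-- Polishchuk's operator
`𝒟 = -g ∂₁ + (1/2) ∑_{m,n ≥ 1} binom(m+n, n) x_{m+n-1} ∂_m ∂_n`; in our indexing,
with `a = m−1`, `b = n−1`, the second term is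
`(1/2) ∑_{a,b ≥ 0} binom(a+b+2, b+1) X(a+b) ∂_{X a} ∂_{X b}`.  On a given polynomial
`p` only the finitely many terms with both variables occurring in `p` are nonzero, so
the sum may be cut off beyond all variable indices of `p`. -/
def Dop (g : ℕ) (p : MvPolynomial ℕ ℚ) : MvPolynomial ℕ ℚ :=
  -(g : ℚ) • pderiv 0 p +
    (1/2 : ℚ) •
      ∑ a ∈ Finset.range (p.vars.sup id + 1), ∑ b ∈ Finset.range (p.vars.sup id + 1),
        (((a + b + 2).choose (b + 1) : ℚ)) • (X (a + b) * pderiv a (pderiv b p))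

/-- `R^{>g}`: span of monomials of codimension `> g`. -/
def Rgt (g : ℕ) : Submodule ℚ (MvPolynomial ℕ ℚ) :=
  Submodule.span ℚ { p | ∃ d : ℕ →₀ ℕ, g < codimW d ∧ p = monomial d (1 : ℚ) }

/-- `Fil¹R^g`: span of monomials of codimension `g` and level `≥ 1`. -/
def Fil1Rg (g : ℕ) : Submodule ℚ (MvPolynomial ℕ ℚ) :=
  Submodule.span ℚ
    { p | ∃ d : ℕ →₀ ℕ, codimW d = g ∧ 1 ≤ levelW d ∧ p = monomial d (1 : ℚ) }

/-- Polishchuk's ideal of universal relations `I = R^{>g} + ∑_{n ≥ 0} 𝒟ⁿ(Fil¹R^g)`. -/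
def Ipol (g : ℕ) : Submodule ℚ (MvPolynomial ℕ ℚ) :=
  Rgt g ⊔ ⨆ n : ℕ, Submodule.span ℚ ((Dop g)^[n] '' (Fil1Rg g : Set (MvPolynomial ℕ ℚ)))

section LadderOperators

variable {M : Type*} [AddCommGroup M] [Module ℚ M] {W : ℤ → Submodule ℚ M}
  {D E : Module.End ℚ M} {c : ℤ}

theorem pow_apply_mem_sub (hD : ∀ i, ∀ v ∈ W i, D v ∈ W (i - 1)) (n : ℕ) {i : ℤ} {v : M}
    (hv : v ∈ W i) : (D ^ n) v ∈ W (i - n) := by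
  induction n with
  | zero => simpa using hv
  | succ n ih =>
    rw [pow_succ', Module.End.mul_apply]
    convert hD _ _ ih using 2
    push_cast
    ring

theorem pow_apply_mem_add (hE : ∀ i, ∀ v ∈ W i, E v ∈ W (i + 1)) (n : ℕ) {i : ℤ} {v : M}
    (hv : v ∈ W i) : (E ^ n) v ∈ W (i + n) := by
  induction n with
  | zero => simpa using hv
  | succ n ih =>
    rw [pow_succ', Module.End.mul_apply]
    convert hE _ _ ih using 2
    push_cast
    ring

theorem lower_raise_pow (hE : ∀ i, ∀ v ∈ W i, E v ∈ W (i + 1))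
    (hDE : ∀ i, ∀ v ∈ W i, D (E v) = E (D v) + ((2 * i - c : ℤ) : ℚ) • v)
    (N : ℕ) {i : ℤ} {v : M} (hv : v ∈ W i) :
    D ((E ^ N) v) = (E ^ N) (D v) + ((N : ℚ) * (2 * i - c + N - 1)) • (E ^ (N - 1)) v := by
  induction N with
  | zero => simp
  | succ N ih =>
    rw [pow_succ', Module.End.mul_apply, hDE _ _ (pow_apply_mem_add hE N hv), ih, map_add,
      map_smul, Module.End.mul_apply, add_assoc, Nat.add_sub_cancel]
    congr 1
    rcases N with _ | N
    · simp
    · rw [Nat.add_sub_cancel, ← Module.End.mul_apply, ← pow_succ', ← add_smul]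
      congr 1
      push_cast
      ring

/-- Normal ordering of `D ^ a * E ^ N` on a weight vector of an `sl₂`-triple. -/
theorem lower_pow_raise_pow (hD : ∀ i, ∀ v ∈ W i, D v ∈ W (i - 1))
    (hE : ∀ i, ∀ v ∈ W i, E v ∈ W (i + 1))
    (hDE : ∀ i, ∀ v ∈ W i, D (E v) = E (D v) + ((2 * i - c : ℤ) : ℚ) • v)
    (a N : ℕ) {i : ℤ} {v : M} (hv : v ∈ W i) :
    (D ^ a) ((E ^ N) v) = ∑ k ∈ Finset.range (a + 1),
      ((N.descFactorial k : ℚ) * a.choose k *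
        (ascPochhammer ℚ k).eval (2 * i - c + N - a : ℚ)) • (E ^ (N - k)) ((D ^ (a - k)) v) := by
  induction a with
  | zero => simp
  | succ a ih =>
    set f : ℕ → ℚ := fun k => (N.descFactorial k : ℚ) * a.choose k *
        (ascPochhammer ℚ k).eval (2 * i - c + N - a : ℚ) with hf
    set u : ℕ → M := fun k => (E ^ (N - k)) ((D ^ (a + 1 - k)) v) with hu
    set e : ℕ → ℚ := fun k => ((N - k : ℕ) : ℚ) * (2 * (i - (a - k)) - c + (N - k : ℕ) - 1) with he
    have step : ∀ k ∈ Finset.range (a + 1),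
        D (f k • (E ^ (N - k)) ((D ^ (a - k)) v)) = f k • u k + (f k * e k) • u (k + 1) := by
      intro k hk
      have hka : k ≤ a := Nat.lt_succ_iff.mp (Finset.mem_range.mp hk)
      rw [map_smul, lower_raise_pow hE hDE _ (pow_apply_mem_sub hD _ hv), smul_add, smul_smul]
      simp only [hu, he]
      rw [← Module.End.mul_apply D, ← pow_succ', show a + 1 - k = a - k + 1 by omega,
        show a + 1 - (k + 1) = a - k by omega, show N - (k + 1) = N - k - 1 by omega]
      congr 3
      push_cast [hka]
      ring
    have htop : f (a + 1) = 0 := by simp [hf]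
    rw [pow_succ', Module.End.mul_apply, ih, map_sum, Finset.sum_congr rfl step,
      Finset.sum_add_distrib]
    have hext : ∑ k ∈ Finset.range (a + 1), f k • u k
        = ∑ k ∈ Finset.range (a + 1), f (k + 1) • u (k + 1) + f 0 • u 0 := by
      rw [← Finset.sum_range_succ' (fun k => f k • u k), Finset.sum_range_succ _ (a + 1), htop,
        zero_smul, add_zero]
    rw [hext, Finset.sum_range_succ' _ (a + 1), add_right_comm, ← Finset.sum_add_distrib]
    congr 1
    · refine Finset.sum_congr rfl fun k hk => ?_
      have hka : k ≤ a := Nat.lt_succ_iff.mp (Finset.mem_range.mp hk)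
      rw [← add_smul]
      congr 1
      simp only [hf, he]
      rcases lt_or_ge N k with hN | hN
      · simp [Nat.descFactorial_of_lt hN]
      have hch : (a.choose (k + 1) : ℚ) * (k + 1) = a.choose k * (a - k) := by
        have := Nat.choose_succ_right_eq a k
        have h2 : ((a.choose (k + 1) * (k + 1) : ℕ) : ℚ) = (a.choose k * (a - k) : ℕ) := by
          rw [this]
        push_cast [hka] at h2
        exact h2
      rw [ascPochhammer_succ_eval, Nat.descFactorial_succ, ascPochhammer_succ_left,
        Polynomial.eval_mul, Polynomial.eval_X, Polynomial.eval_comp, Nat.choose_succ_succ]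
      push_cast [hN]
      simp only [Polynomial.eval_add, Polynomial.eval_X, Polynomial.eval_one]
      rw [show (2 * i - c + N - (a + 1) + 1 : ℚ) = 2 * i - c + N - a by ring]
      linear_combination ((N : ℚ) - k) * N.descFactorial k *
        (ascPochhammer ℚ k).eval (2 * i - c + N - a : ℚ) * hch
    · simp [hf, hu]

theorem lower_pow_raise_pow_comm (hD : ∀ i, ∀ v ∈ W i, D v ∈ W (i - 1))
    (hE : ∀ i, ∀ v ∈ W i, E v ∈ W (i + 1))
    (hDE : ∀ i, ∀ v ∈ W i, D (E v) = E (D v) + ((2 * i - c : ℤ) : ℚ) • v)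
    (a N : ℕ) {i : ℤ} (h : 2 * i - c + N = a) {v : M} (hv : v ∈ W i) :
    (D ^ a) ((E ^ N) v) = (E ^ N) ((D ^ a) v) := by
  have h0 : (2 * i - c + N - a : ℚ) = 0 := by
    rw [sub_eq_zero]
    exact_mod_cast h
  rw [lower_pow_raise_pow hD hE hDE a N hv, Finset.sum_range_succ', h0, Finset.sum_eq_zero]
  · simp
  · intro k _
    simp

end LadderOperators

theorem codimW_add (d e : ℕ →₀ ℕ) : codimW (d + e) = codimW d + codimW e :=
  Finsupp.sum_add_index' (fun _ => by simp) (fun _ _ _ => by ring)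

theorem levelW_add (d e : ℕ →₀ ℕ) : levelW (d + e) = levelW d + levelW e :=
  Finsupp.sum_add_index' (fun _ => by simp) (fun _ _ _ => by ring)

theorem codimW_single (a n : ℕ) : codimW (Finsupp.single a n) = (a + 1) * n := by
  simp [codimW]

theorem levelW_single (a n : ℕ) : levelW (Finsupp.single a n) = a * n := by
  simp [levelW]

theorem codimW_eq (d : ℕ →₀ ℕ) : codimW d = levelW d + d.sum fun _ e => e := by
  simp only [codimW, levelW, Finsupp.sum, ← Finset.sum_add_distrib]
  exact Finset.sum_congr rfl fun _ _ => by ring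

theorem codimW_le (d : ℕ →₀ ℕ) : codimW d ≤ 2 * levelW d + d 0 := by
  induction d using Finsupp.induction_linear with
  | zero => simp [codimW]
  | add d e hd he => rw [codimW_add, levelW_add, Finsupp.add_apply]; omega
  | single a n =>
    rw [codimW_single, levelW_single]
    rcases a with _ | a
    · simp
    · rw [Finsupp.single_eq_of_ne a.succ_ne_zero.symm]
      nlinarith

/-- The operator `𝒟` with both summation indices cut off at `N`. -/
def truncDop (g N : ℕ) : Module.End ℚ (MvPolynomial ℕ ℚ) :=
  -(g : ℚ) • (pderiv 0).toLinearMap +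
    (1/2 : ℚ) • ∑ a ∈ Finset.range N, ∑ b ∈ Finset.range N,
      (((a + b + 2).choose (b + 1) : ℚ)) •
        (LinearMap.mulLeft ℚ (X (a + b)) ∘ₗ (pderiv a).toLinearMap ∘ₗ (pderiv b).toLinearMap)

theorem truncDop_apply (g N : ℕ) (p : MvPolynomial ℕ ℚ) :
    truncDop g N p = -(g : ℚ) • pderiv 0 p + (1/2 : ℚ) •
      ∑ a ∈ Finset.range N, ∑ b ∈ Finset.range N,
        (((a + b + 2).choose (b + 1) : ℚ)) • (X (a + b) * pderiv a (pderiv b p)) := by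
  simp [truncDop, LinearMap.sum_apply]

theorem pderiv_eq_zero_of_sup_vars_lt {p : MvPolynomial ℕ ℚ} {a : ℕ} (h : p.vars.sup id < a) :
    pderiv a p = 0 :=
  pderiv_eq_zero_of_notMem_vars fun ha => h.not_ge (Finset.le_sup (f := id) ha)

theorem pderiv_comm (a b : ℕ) (p : MvPolynomial ℕ ℚ) :
    pderiv a (pderiv b p) = pderiv b (pderiv a p) := by
  ext m
  simp only [coeff_pderiv, Finsupp.add_apply]
  rcases eq_or_ne a b with rfl | hab
  · rfl
  · rw [add_right_comm, Finsupp.single_eq_of_ne hab, Finsupp.single_eq_of_ne hab.symm]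
    ring_nf

theorem Dop_eq_truncDop (g : ℕ) {N : ℕ} {p : MvPolynomial ℕ ℚ} (h : p.vars.sup id < N) :
    Dop g p = truncDop g N p := by
  rw [truncDop_apply, Dop]
  congr 2
  have hsub : Finset.range (p.vars.sup id + 1) ⊆ Finset.range N :=
    Finset.range_subset_range.mpr h
  rw [← Finset.sum_subset hsub]
  · refine Finset.sum_congr rfl fun a _ => Finset.sum_subset hsub fun b _ hb => ?_
    rw [pderiv_eq_zero_of_sup_vars_lt (p := p) (by simpa using hb)]
    simp
  · intro a _ ha
    refine Finset.sum_eq_zero fun b _ => ?_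
    rw [pderiv_comm, pderiv_eq_zero_of_sup_vars_lt (p := p) (by simpa using ha)]
    simp

/-- The operator `𝒟` as a linear map. -/
def DopLin (g : ℕ) : Module.End ℚ (MvPolynomial ℕ ℚ) where
  toFun := Dop g
  map_add' p q := by
    set N := max (p.vars.sup id) (max (q.vars.sup id) ((p + q).vars.sup id)) + 1
    rw [Dop_eq_truncDop g (N := N) (by omega), Dop_eq_truncDop g (N := N) (p := p) (by omega),
      Dop_eq_truncDop g (N := N) (p := q) (by omega), map_add]
  map_smul' r p := by
    set N := max (p.vars.sup id) ((r • p).vars.sup id) + 1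
    rw [Dop_eq_truncDop g (N := N) (by omega), Dop_eq_truncDop g (N := N) (p := p) (by omega),
      map_smul, RingHom.id_apply]

/-- The bigraded pieces `R^i_{(j)}`, indexed by integers. -/
def bigraded (j i : ℤ) : Submodule ℚ (MvPolynomial ℕ ℚ) :=
  Submodule.span ℚ
    { p | ∃ d : ℕ →₀ ℕ, (codimW d : ℤ) = i ∧ (levelW d : ℤ) = j ∧ p = monomial d (1 : ℚ) }

theorem monomial_mem_bigraded {i j : ℤ} {d : ℕ →₀ ℕ} (hi : (codimW d : ℤ) = i)
    (hj : (levelW d : ℤ) = j) (r : ℚ) : monomial d r ∈ bigraded j i := by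
  have : monomial d r = r • monomial d (1 : ℚ) := by simp [smul_monomial]
  rw [this]
  exact Submodule.smul_mem _ _ (Submodule.subset_span ⟨d, hi, hj, rfl⟩)

theorem bigraded_eq_bot {i j : ℤ} (hj : 1 ≤ j) (hij : i ≤ j) : bigraded j i = ⊥ := by
  rw [bigraded, Submodule.span_eq_bot]
  rintro _ ⟨d, hi, hl, rfl⟩
  exfalso
  have h := codimW_eq d
  have hd : (d.sum fun _ e => e) = 0 := by omega
  have hd0 : d = 0 := by
    ext v
    by_contra hv
    exact hv (Finset.sum_eq_zero_iff.mp hd v (Finsupp.mem_support_iff.mpr hv))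
  subst hd0
  simp [levelW] at hl
  omega

theorem X_mul_mem_bigraded (a : ℕ) {i j : ℤ} {p : MvPolynomial ℕ ℚ} (hp : p ∈ bigraded j i) :
    X a * p ∈ bigraded (j + a) (i + a + 1) := by
  induction hp using Submodule.span_induction with
  | mem p hp =>
    obtain ⟨d, hi, hj, rfl⟩ := hp
    rw [X, monomial_mul]
    refine monomial_mem_bigraded ?_ ?_ _
    · rw [codimW_add, codimW_single]
      push_cast
      linarith
    · rw [levelW_add, levelW_single]
      push_cast
      linarith
  | zero => simp
  | add p q _ _ hp hq =>
    rw [mul_add]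
    exact add_mem hp hq
  | smul r p _ hp =>
    rw [mul_smul_comm]
    exact Submodule.smul_mem _ _ hp

theorem pderiv_mem_bigraded (a : ℕ) {i j : ℤ} {p : MvPolynomial ℕ ℚ} (hp : p ∈ bigraded j i) :
    pderiv a p ∈ bigraded (j - a) (i - a - 1) := by
  induction hp using Submodule.span_induction with
  | mem p hp =>
    obtain ⟨d, hi, hj, rfl⟩ := hp
    rw [pderiv_monomial]
    rcases Nat.eq_zero_or_pos (d a) with h | h
    · simp [h]
    obtain ⟨e, rfl⟩ : ∃ e, d = e + Finsupp.single a 1 :=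
      le_iff_exists_add'.mp (Finsupp.single_le_iff.mpr h)
    rw [codimW_add, codimW_single] at hi
    rw [levelW_add, levelW_single] at hj
    push_cast at hi hj
    rw [add_tsub_cancel_right]
    exact monomial_mem_bigraded (by linarith) (by linarith) _
  | zero => simp
  | add p q _ _ hp hq =>
    rw [map_add]
    exact add_mem hp hq
  | smul r p _ hp =>
    rw [Derivation.map_smul]
    exact Submodule.smul_mem _ _ hp

theorem DopLin_mem_bigraded (g : ℕ) (j i : ℤ) (p : MvPolynomial ℕ ℚ) (hp : p ∈ bigraded j i) :
    DopLin g p ∈ bigraded j (i - 1) := by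
  change Dop g p ∈ _
  rw [Dop]
  refine add_mem (Submodule.smul_mem _ _ ?_) (Submodule.smul_mem _ _
    (sum_mem fun a _ => sum_mem fun b _ => Submodule.smul_mem _ _ ?_))
  · simpa using pderiv_mem_bigraded 0 hp
  · have h := X_mul_mem_bigraded (a + b) (pderiv_mem_bigraded a (pderiv_mem_bigraded b hp))
    rwa [show j - b - a + (a + b : ℕ) = j by push_cast; ring,
      show i - b - 1 - a - 1 + (a + b : ℕ) + 1 = i - 1 by push_cast; ring] at h

theorem sum_X_mul_pderiv {i j : ℤ} {p : MvPolynomial ℕ ℚ} (hp : p ∈ bigraded j i) {N : ℕ}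
    (hN : p.vars.sup id < N) :
    ∑ a ∈ Finset.range N, ((a + 2 : ℕ) : ℚ) • (X a * pderiv a p) = ((2 * i - j : ℤ) : ℚ) • p := by
  suffices h : ∃ N₀, ∀ N ≥ N₀,
      ∑ a ∈ Finset.range N, ((a + 2 : ℕ) : ℚ) • (X a * pderiv a p)
        = ((2 * i - j : ℤ) : ℚ) • p by
    obtain ⟨N₀, h⟩ := h
    rw [← h (max N N₀) (le_max_right _ _)]
    refine Finset.sum_subset (Finset.range_subset_range.mpr (le_max_left _ _)) fun a _ ha => ?_
    rw [pderiv_eq_zero_of_sup_vars_lt (hN.trans_le (by simpa using ha))]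
    simp
  clear hN
  induction hp using Submodule.span_induction with
  | mem p hp =>
    obtain ⟨d, rfl, rfl, rfl⟩ := hp
    refine ⟨d.support.sup id + 1, fun N hN => ?_⟩
    have hsub : d.support ⊆ Finset.range N := fun v hv =>
      Finset.mem_range.mpr ((Nat.lt_succ_of_le (Finset.le_sup (f := id) hv)).trans_le hN)
    simp_rw [X_mul_pderiv_monomial, ← Nat.cast_smul_eq_nsmul ℚ, smul_smul]
    rw [← Finset.sum_smul]
    congr 1
    have hc : (2 * codimW d - levelW d : ℤ) = ((d.sum fun v e => (v + 2) * e : ℕ) : ℤ) := by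
      have : 2 * codimW d = levelW d + d.sum fun v e => (v + 2) * e := by
        simp only [codimW, levelW, Finsupp.sum, ← Finset.sum_add_distrib, Finset.mul_sum]
        exact Finset.sum_congr rfl fun _ _ => by ring
      omega
    rw [hc, Finsupp.sum_of_support_subset _ hsub _ (by simp)]
    push_cast
    rfl
  | zero => exact ⟨0, by simp⟩
  | add p q _ _ hp hq =>
    obtain ⟨A, hA⟩ := hp
    obtain ⟨B, hB⟩ := hq
    refine ⟨max A B, fun N hN => ?_⟩
    simp only [map_add, mul_add, smul_add, Finset.sum_add_distrib]
    rw [hA N (le_of_max_le_left hN), hB N (le_of_max_le_right hN)]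
  | smul r p _ hp =>
    obtain ⟨A, hA⟩ := hp
    refine ⟨A, fun N hN => ?_⟩
    rw [smul_comm, ← hA N hN, Finset.smul_sum]
    refine Finset.sum_congr rfl fun a _ => ?_
    rw [Derivation.map_smul, mul_smul_comm, smul_comm]

theorem truncDop_X_zero_mul (g : ℕ) {N : ℕ} (hN : 0 < N) (p : MvPolynomial ℕ ℚ) :
    truncDop g N (X 0 * p) = X 0 * truncDop g N p - (g : ℚ) • p +
      ∑ a ∈ Finset.range N, ((a + 2 : ℕ) : ℚ) • (X a * pderiv a p) := by
  have h1 : ∀ a, pderiv a (X 0 * p) = X 0 * pderiv a p + if a = 0 then p else 0 := by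
    intro a
    rw [pderiv_mul]
    split_ifs with h
    · subst h
      rw [pderiv_X_self]
      ring
    · rw [pderiv_X_of_ne (Ne.symm h)]
      ring
  have h2 : ∀ a b, pderiv a (pderiv b (X 0 * p)) = X 0 * pderiv a (pderiv b p) +
      (if a = 0 then pderiv b p else 0) + (if b = 0 then pderiv a p else 0) := by
    intro a b
    rw [h1 b, map_add, pderiv_mul]
    rcases eq_or_ne a 0 with rfl | h
    · rw [if_pos rfl, pderiv_X_self]
      split_ifs with hb
      · subst hb
        ring
      · rw [map_zero]
        ring
    · rw [pderiv_X_of_ne (Ne.symm h)]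
      split_ifs <;> simp_all
  have h3 : ∀ a b : ℕ, (((a + b + 2).choose (b + 1) : ℚ)) •
        (X (a + b) * pderiv a (pderiv b (X 0 * p))) =
      X 0 * ((((a + b + 2).choose (b + 1) : ℚ)) • (X (a + b) * pderiv a (pderiv b p))) +
      (if a = 0 then ((b + 2 : ℕ) : ℚ) • (X b * pderiv b p) else 0) +
      (if b = 0 then ((a + 2 : ℕ) : ℚ) • (X a * pderiv a p) else 0) := by
    intro a b
    have hA : a = 0 → (a + b + 2).choose (b + 1) = b + 2 := by
      rintro rfl
      rw [zero_add, Nat.choose_succ_self_right]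
    have hB : b = 0 → (a + b + 2).choose (b + 1) = a + 2 := by
      rintro rfl
      simp
    rw [h2, mul_add, mul_add, smul_add, smul_add]
    congr 1
    · congr 1
      · rw [mul_smul_comm, mul_left_comm]
      · split_ifs with h
        · rw [hA h, h, zero_add]
        · simp
    · split_ifs with h
      · rw [hB h, h, add_zero]
      · simp
  rw [truncDop_apply, truncDop_apply, h1]
  simp_rw [h3, Finset.sum_add_distrib, Finset.sum_ite_irrel, Finset.sum_ite_eq']
  simp only [Finset.sum_const_zero, Finset.sum_ite_eq', Finset.mem_range, hN, if_true,
    ← Finset.mul_sum]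
  simp only [smul_add, mul_add, smul_eq_C_mul]
  have hC : (C (1 / 2 : ℚ) : MvPolynomial ℕ ℚ) + C (1 / 2) = 1 := by
    rw [← C_add]
    norm_num
  simp only [map_neg]
  linear_combination (∑ a ∈ Finset.range N, C ((a + 2 : ℕ) : ℚ) * (X a * pderiv a p)) * hC

theorem DopLin_X_zero_mul (g : ℕ) {i j : ℤ} {p : MvPolynomial ℕ ℚ} (hp : p ∈ bigraded j i) :
    DopLin g (X 0 * p) = X 0 * DopLin g p + ((2 * i - (j + g) : ℤ) : ℚ) • p := by
  change Dop g _ = X 0 * Dop g p + _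
  set N := max (p.vars.sup id) ((X 0 * p).vars.sup id) + 1
  rw [Dop_eq_truncDop g (N := N) (by omega), Dop_eq_truncDop g (N := N) (p := p) (by omega),
    truncDop_X_zero_mul g (by omega), sum_X_mul_pderiv hp (by omega), sub_add, ← sub_smul,
    sub_eq_add_neg, ← neg_smul]
  congr 2
  push_cast
  ring

theorem DopLin_pow_eq_zero (g : ℕ) {d : ℕ →₀ ℕ} (hd : codimW d = g) (hl : 1 ≤ levelW d) :
    (DopLin g ^ levelW d) (monomial d 1) = 0 := by
  set j := levelW d with hj
  have hD := DopLin_mem_bigraded g j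
  have hl' : (1 : ℤ) ≤ j := by exact_mod_cast hl
  rcases lt_or_ge g (2 * j) with hg | hg
  · have := pow_apply_mem_sub hD j (monomial_mem_bigraded (d := d) rfl rfl 1)
    rwa [bigraded_eq_bot hl' (by omega), Submodule.mem_bot] at this
  · obtain ⟨N, hN⟩ := Nat.exists_eq_add_of_le hg
    have h0 := codimW_le d
    obtain ⟨e, he⟩ := le_iff_exists_add.mp (Finsupp.single_le_iff.mpr (show N ≤ d 0 by omega))
    have hec : (codimW e : ℤ) = 2 * j := by
      rw [he, codimW_add, codimW_single] at hd
      push_cast [hN] at hd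
      omega
    have hel : (levelW e : ℤ) = j := by
      rw [hj, he, levelW_add, levelW_single]
      simp
    have hE : ∀ i, ∀ v ∈ bigraded j i, LinearMap.mulLeft ℚ (X 0) v ∈ bigraded j (i + 1) := by
      intro i v hv
      simpa using X_mul_mem_bigraded 0 hv
    have hm : monomial d (1 : ℚ) = (LinearMap.mulLeft ℚ (X 0) ^ N) (monomial e 1) := by
      rw [LinearMap.pow_mulLeft, LinearMap.mulLeft_apply, X_pow_eq_monomial, monomial_mul, he,
        one_mul]
    have hmem := monomial_mem_bigraded hec hel 1
    rw [hm, lower_pow_raise_pow_comm hD hE (fun i v hv => DopLin_X_zero_mul g hv) j N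
      (by omega) hmem]
    have := pow_apply_mem_sub hD j hmem
    rw [bigraded_eq_bot hl' (by omega), Submodule.mem_bot] at this
    rw [this, map_zero]

theorem coeff_eq_zero_of_mem_bigraded {i j : ℤ} {p : MvPolynomial ℕ ℚ} (hp : p ∈ bigraded j i)
    {d : ℕ →₀ ℕ} (h : ¬((codimW d : ℤ) = i ∧ (levelW d : ℤ) = j)) : coeff d p = 0 := by
  induction hp using Submodule.span_induction with
  | mem p hp =>
    obtain ⟨e, hi, hj, rfl⟩ := hp
    rw [coeff_monomial, if_neg]
    rintro rfl
    exact h ⟨hi, hj⟩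
  | zero => simp
  | add p q _ _ hp hq => rw [coeff_add, hp, hq, add_zero]
  | smul r p _ hp => rw [coeff_smul, hp, smul_zero]

theorem coeff_DopLin_pow_eq_zero (g n : ℕ) {p : MvPolynomial ℕ ℚ} (hp : p ∈ Fil1Rg g)
    {d : ℕ →₀ ℕ} (hd : codimW d + levelW d ≤ g) : coeff d ((DopLin g ^ n) p) = 0 := by
  induction hp using Submodule.span_induction with
  | mem p hp =>
    obtain ⟨e, he, hl, rfl⟩ := hp
    rcases lt_or_ge n (levelW e) with hn | hn
    · refine coeff_eq_zero_of_mem_bigraded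
        (pow_apply_mem_sub (DopLin_mem_bigraded g _) n (monomial_mem_bigraded rfl rfl 1)) ?_
      omega
    · obtain ⟨k, rfl⟩ := Nat.exists_eq_add_of_le' hn
      rw [pow_add, Module.End.mul_apply, DopLin_pow_eq_zero g he hl, map_zero, coeff_zero]
  | zero => simp
  | add p q _ _ hp hq => rw [map_add, coeff_add, hp, hq, add_zero]
  | smul r p _ hp => rw [map_smul, coeff_smul, hp, smul_zero]

theorem coeff_eq_zero_of_mem_Ipol {g : ℕ} {p : MvPolynomial ℕ ℚ} (hp : p ∈ Ipol g)
    {d : ℕ →₀ ℕ} (hd : codimW d + levelW d ≤ g) : coeff d p = 0 := by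
  suffices h : Ipol g ≤ LinearMap.ker (lcoeff ℚ d) from LinearMap.mem_ker.mp (h hp)
  refine sup_le (Submodule.span_le.mpr ?_) (iSup_le fun n => Submodule.span_le.mpr ?_)
  · rintro _ ⟨e, he, rfl⟩
    change coeff d (monomial e (1 : ℚ)) = 0
    rw [coeff_monomial, if_neg]
    rintro rfl
    omega
  · rintro _ ⟨q, hq, rfl⟩
    have := coeff_DopLin_pow_eq_zero g n hq hd
    rwa [Module.End.pow_apply] at this

/-- if `i + j ≤ g` then `I ∩ R^i_{(j)} = {0}`, i.e. the natural map
`R^i_{(j)} → 𝓡^i_{(j)}` is an isomorphism. -/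
theorem stmt4 (g : ℕ) (hg : 3 ≤ g) (i j : ℕ) (hij : i + j ≤ g) :
    Ipol g ⊓ Rij i j = ⊥ := by
  rw [Submodule.eq_bot_iff]
  rintro p ⟨hI, hR⟩
  have hB : p ∈ bigraded j i := by
    refine Submodule.span_mono ?_ hR
    rintro _ ⟨d, hi, hj, rfl⟩
    exact ⟨d, by rw [hi], by rw [hj], rfl⟩
  ext d
  rw [coeff_zero]
  by_cases h : (codimW d : ℤ) = i ∧ (levelW d : ℤ) = j
  · exact coeff_eq_zero_of_mem_Ipol hI (by omega)
  · exact coeff_eq_zero_of_mem_bigraded hB h
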